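/- arXiv:1410.2822 — 2 statements merged into one kernel-verified Lean document; each statement's English description precedes it below -/
import Mathlib

section
/- Let P_1 →(φ) P_0 →(ψ) X → 0 be an exact sequence in an abelian category with P_0 and P_1 projective (a projective presentation of X). Then ψ is a projective cover of X if and only if φ belongs to Rad(P_1, P_0), i.e., if and only if φ∘χ lies in the Jacobson radical J(End(P_0)) for every morphism χ : P_0 → P_1. -/
open CategoryTheory CategoryTheory.Limits

universe v u

/-- An epimorphism `φ : X ⟶ Y` is *essential* if every morphism `α : X' ⟶ X` for which
`α ≫ φ` is an epimorphism is itself an epimorphism. -/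
def IsEssentialEpi {A : Type u} [Category.{v} A] {X Y : A} (φ : X ⟶ Y) : Prop :=
  Epi φ ∧ ∀ ⦃X' : A⦄ (α : X' ⟶ X), Epi (α ≫ φ) → Epi α

/-- A *projective cover* of `X` is an essential epimorphism `φ : P ⟶ X` with `P`
projective. -/
def IsProjectiveCover {A : Type u} [Category.{v} A] {P X : A} (φ : P ⟶ X) : Prop :=
  Projective P ∧ IsEssentialEpi φ

/-- The Jacobson radical of a ring: the intersection of all maximal right ideals
(coatoms of the lattice of submodules of `R` as a right module over itself). -/
def jacobsonRadical (R : Type*) [Ring R] : Set R :=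
  {x : R | ∀ I : Submodule Rᵐᵒᵖ R, IsCoatom I → x ∈ I}

/-- If `x` lies in the Jacobson radical, then `1 - x` has a right inverse. -/
lemma exists_mul_eq_one_of_mem_jacobsonRadical {R : Type*} [Ring R] {x : R}
    (hx : x ∈ jacobsonRadical R) : ∃ z, (1 - x) * z = 1 := by
  have : Module.Finite Rᵐᵒᵖ R := by
    refine ⟨⟨{1}, (Submodule.eq_top_iff'.2 fun y => ?_)⟩⟩
    rw [Finset.coe_singleton, Submodule.mem_span_singleton]
    exact ⟨MulOpposite.op y, by simp⟩
  rcases eq_top_or_exists_le_coatom (Submodule.span Rᵐᵒᵖ {1 - x}) with h | ⟨I, hI, hle⟩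
  · have h1 : (1 : R) ∈ Submodule.span Rᵐᵒᵖ {1 - x} := h ▸ Submodule.mem_top
    obtain ⟨z, hz⟩ := Submodule.mem_span_singleton.1 h1
    exact ⟨z.unop, hz⟩
  · have h1 : (1 : R) ∈ I := by
      simpa using I.add_mem (hle (Submodule.mem_span_singleton_self _)) (hx I hI)
    refine absurd (Submodule.eq_top_iff'.2 fun y => ?_) hI.1
    simpa using I.smul_mem (MulOpposite.op y) h1

/-- If `1 - x * r` has a right inverse for every `r`, then `x` lies in the Jacobson radical. -/
lemma mem_jacobsonRadical_of_forall_exists_mul_eq_one {R : Type*} [Ring R] {x : R}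
    (hx : ∀ r, ∃ s, (1 - x * r) * s = 1) : x ∈ jacobsonRadical R := by
  intro I hI
  by_contra hxI
  have htop : I ⊔ Submodule.span Rᵐᵒᵖ {x} = ⊤ :=
    hI.2 _ (left_lt_sup.2 fun h => hxI (h (Submodule.mem_span_singleton_self x)))
  have h1 : (1 : R) ∈ I ⊔ Submodule.span Rᵐᵒᵖ {x} := htop ▸ Submodule.mem_top
  obtain ⟨i, hi, y, hy, hiy⟩ := Submodule.mem_sup.1 h1
  obtain ⟨r, rfl⟩ := Submodule.mem_span_singleton.1 hy
  obtain ⟨s, hs⟩ := hx r.unop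
  have hi' : i = 1 - x * r.unop := eq_sub_of_add_eq hiy
  have h1I : (1 : R) ∈ I := by
    simpa [hi', hs] using I.smul_mem (MulOpposite.op s) hi
  refine hI.1 (Submodule.eq_top_iff'.2 fun y => ?_)
  simpa using I.smul_mem (MulOpposite.op y) h1I

/-- A morphism from a projective object that is killed by `ψ` lifts through `φ` if the image
of `φ` is the kernel of `ψ`. -/
lemma exists_lift_of_imageSubobject_eq_kernelSubobject {A : Type u} [Category.{v} A] [Abelian A]
    {P W Y X : A} [Projective P] {φ : W ⟶ Y} {ψ : Y ⟶ X}
    (hexact : imageSubobject φ = kernelSubobject ψ) (f : P ⟶ Y) (hf : f ≫ ψ = 0) :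
    ∃ χ : P ⟶ W, χ ≫ φ = f := by
  have hfac : (imageSubobject φ).Factors f := hexact ▸ kernelSubobject_factors ψ f hf
  refine ⟨Projective.factorThru ((imageSubobject φ).factorThru f hfac)
    (factorThruImageSubobject φ), ?_⟩
  refine (congrArg (_ ≫ ·) (imageSubobject_arrow_comp φ).symm).trans ?_
  rw [← Category.assoc, Projective.factorThru_comp, Subobject.factorThru_arrow]

/-- Let `P₁ ⟶ P₀ ⟶ X ⟶ 0` be a projective presentation in an abelian category, i.e.
`P₀, P₁` are projective, `ψ` is an epimorphism and the sequence is exact at `P₀`.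
Then `ψ` is a projective cover of `X` if and only if `φ ∈ Rad(P₁, P₀)`, i.e. `χ ≫ φ`
lies in the Jacobson radical of `End P₀` for every `χ : P₀ ⟶ P₁`. -/
theorem projectiveCover_iff_radical_presentation {A : Type u} [Category.{v} A] [Abelian A]
    {P₁ P₀ X : A} (φ : P₁ ⟶ P₀) (ψ : P₀ ⟶ X)
    (hP₀ : Projective P₀) (hP₁ : Projective P₁) (hepi : Epi ψ)
    (hw : φ ≫ ψ = 0) (hexact : imageSubobject φ = kernelSubobject ψ) :
    IsProjectiveCover ψ ↔ ∀ χ : P₀ ⟶ P₁, (χ ≫ φ) ∈ jacobsonRadical (End P₀) := by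
  constructor
  · rintro ⟨-, -, hess⟩ χ
    refine mem_jacobsonRadical_of_forall_exists_mul_eq_one (R := End P₀) fun r => ?_
    let i : P₀ ⟶ P₀ := 𝟙 P₀ - r ≫ χ ≫ φ
    have hi : i ≫ ψ = ψ := by simp [i, Preadditive.sub_comp, hw]
    have : Epi i := hess i (hi.symm ▸ hepi)
    exact ⟨Projective.factorThru (𝟙 P₀) i, Projective.factorThru_comp (𝟙 P₀) i⟩
  · intro h
    refine ⟨hP₀, hepi, fun X' α hα => ?_⟩
    let β : P₀ ⟶ X' := Projective.factorThru ψ (α ≫ ψ)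
    have hβ : β ≫ α ≫ ψ = ψ := Projective.factorThru_comp ψ (α ≫ ψ)
    obtain ⟨χ, hχ⟩ := exists_lift_of_imageSubobject_eq_kernelSubobject hexact
      (𝟙 P₀ - β ≫ α) (by simp [Preadditive.sub_comp, hβ])
    obtain ⟨z, hz⟩ := exists_mul_eq_one_of_mem_jacobsonRadical (R := End P₀) (h χ)
    have hz' : z ≫ (𝟙 P₀ - χ ≫ φ) = 𝟙 P₀ := hz
    rw [hχ, sub_sub_cancel, ← Category.assoc] at hz'
    exact (SplitEpi.mk (z ≫ β) hz').epi
end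

section
/- For an associative ring Λ the following are equivalent: (1) the category of finitely generated projective right Λ-modules is a Krull-Schmidt category; (2) the right Λ-module Λ admits a decomposition Λ = P_1 ⊕ … ⊕ P_r into submodules such that each P_i has a local endomorphism ring; (3) every simple right Λ-module admits a projective cover; (4) every finitely generated right Λ-module admits a projective cover. -/
open Function

universe u

/-- A surjective linear map `π : P → M` is *essential* if every submodule `U ⊆ P` with
`U ⊔ ker π = ⊤` equals `⊤`; a *projective cover* of `M` is an essential surjection
`π : P → M` with `P` projective. -/
def IsModuleProjectiveCover (R : Type*) [Ring R] {P M : Type*}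
    [AddCommGroup P] [Module R P] [AddCommGroup M] [Module R M] (π : P →ₗ[R] M) : Prop :=
  Module.Projective R P ∧ Function.Surjective π ∧
    ∀ U : Submodule R P, U ⊔ LinearMap.ker π = ⊤ → U = ⊤

/-- A module is *local* if it has a largest proper submodule. -/
def IsLocalModule (R P : Type*) [Ring R] [AddCommGroup P] [Module R P] : Prop :=
  ∃ K : Submodule R P, K ≠ ⊤ ∧ ∀ U : Submodule R P, U ≠ ⊤ → U ≤ K

section

variable {R P Q M : Type*} [Ring R] [AddCommGroup P] [Module R P] [AddCommGroup Q] [Module R Q]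
  [AddCommGroup M] [Module R M]

theorem IsModuleProjectiveCover.isLocalModule [IsSimpleModule R M] {π : P →ₗ[R] M}
    (h : IsModuleProjectiveCover R π) : IsLocalModule R P := by
  have hK : IsCoatom (LinearMap.ker π) := LinearMap.isCoatom_ker_of_surjective h.2.1
  refine ⟨LinearMap.ker π, hK.1, fun U hU => ?_⟩
  by_contra hle
  refine hU (h.2.2 U (hK.2 _ ?_))
  exact lt_of_le_of_ne le_sup_right fun heq => hle (heq ▸ le_sup_left)

theorem isLocalRing_end_of_linearEquiv (e : P ≃ₗ[R] Q) [IsLocalRing (Module.End R P)] :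
    IsLocalRing (Module.End R Q) := by
  let c := e.conjRingEquiv
  have : Nontrivial (Module.End R Q) := c.symm.toEquiv.nontrivial
  refine ⟨fun {a b} hab => ?_⟩
  simpa using IsLocalRing.isUnit_or_isUnit_of_add_one
    (show c.symm a + c.symm b = 1 by rw [← map_add, hab, map_one])

/-- An endomorphism of a projective local module is either invertible or has image in the
largest proper submodule. -/
theorem IsLocalModule.isLocalRing_end [Module.Projective R P] (h : IsLocalModule R P) :
    IsLocalRing (Module.End R P) := by
  obtain ⟨K, hK, hmax⟩ := h
  have hunit (f : Module.End R P) (hf : LinearMap.range f = ⊤) : IsUnit f := by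
    obtain ⟨g, hg⟩ := LinearMap.exists_rightInverse_of_surjective f hf
    have hgf (x : P) : f (g x) = x := LinearMap.congr_fun hg x
    have hsup : LinearMap.range g ⊔ LinearMap.ker f = ⊤ := by
      refine eq_top_iff.2 fun x _ => ?_
      rw [← add_sub_cancel (g (f x)) x]
      exact Submodule.add_mem_sup ⟨_, rfl⟩ (by simp [hgf])
    have hg_top : LinearMap.range g = ⊤ := by
      by_contra hg'
      have hker : LinearMap.ker f = ⊤ := by
        by_contra hk
        exact hK (top_le_iff.1 (hsup ▸ sup_le (hmax _ hg') (hmax _ hk)))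
      rw [LinearMap.ker_eq_top] at hker
      rw [hker, LinearMap.range_zero] at hf
      exact hK (top_le_iff.1 (hf ▸ bot_le))
    rw [Module.End.isUnit_iff]
    refine ⟨fun x y hxy => ?_, LinearMap.range_eq_top.1 hf⟩
    obtain ⟨x, rfl⟩ := LinearMap.range_eq_top.1 hg_top x
    obtain ⟨y, rfl⟩ := LinearMap.range_eq_top.1 hg_top y
    rw [hgf, hgf] at hxy
    rw [hxy]
  have : Nontrivial P := by
    by_contra hP
    rw [not_nontrivial_iff_subsingleton] at hP
    exact hK (Subsingleton.elim _ _)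
  refine ⟨fun {a b} hab => ?_⟩
  by_contra! hn
  refine hK (top_le_iff.1 fun x _ => ?_)
  have hx : a x + b x = x := LinearMap.congr_fun hab x
  rw [← hx]
  exact K.add_mem (hmax _ (fun h => hn.1 (hunit a h)) ⟨x, rfl⟩)
    (hmax _ (fun h => hn.2 (hunit b h)) ⟨x, rfl⟩)

/-- A projective module with local endomorphism ring is a projective cover of each of its
nonzero quotients. -/
theorem isModuleProjectiveCover_of_isLocalRing_end [Module.Projective R P] [Nontrivial M]
    [IsLocalRing (Module.End R P)] {π : P →ₗ[R] M} (hπ : Surjective π) :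
    IsModuleProjectiveCover R π := by
  refine ⟨inferInstance, hπ, fun U hU => ?_⟩
  have hs : Surjective (π ∘ₗ U.subtype) := by
    intro y
    obtain ⟨x, rfl⟩ := hπ y
    obtain ⟨u, hu, k, hk, rfl⟩ := Submodule.mem_sup.1 (hU ▸ Submodule.mem_top : x ∈ _)
    exact ⟨⟨u, hu⟩, by simpa using hk⟩
  obtain ⟨g, hg⟩ := Module.projective_lifting_property (π ∘ₗ U.subtype) π hs
  have hg' (x : P) : π (g x) = π x := LinearMap.congr_fun hg x
  rcases IsLocalRing.isUnit_or_isUnit_of_add_one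
    (add_sub_cancel (U.subtype ∘ₗ g) (1 : Module.End R P)) with h | h
  · refine eq_top_iff.2 fun x _ => ?_
    obtain ⟨y, rfl⟩ := ((Module.End.isUnit_iff _).1 h).2 x
    exact (g y).2
  · obtain ⟨y, hy⟩ := exists_ne (0 : M)
    obtain ⟨x, rfl⟩ := hπ y
    obtain ⟨z, rfl⟩ := ((Module.End.isUnit_iff _).1 h).2 x
    exact absurd (by simp [hg']) hy

theorem projective_of_isInternal {ι : Type*} [DecidableEq ι] [Module.Projective R M]
    {N : ι → Submodule R M} (hN : DirectSum.IsInternal N) (i : ι) :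
    Module.Projective R (N i) := by
  rw [DirectSum.isInternal_submodule_iff_iSupIndep_and_iSup_eq_top] at hN
  have hc : IsCompl (N i) (⨆ (j) (_ : j ≠ i), N j) := by
    refine ⟨hN.1 i, codisjoint_iff.2 (eq_top_iff.2 (hN.2 ▸ iSup_le fun j => ?_))⟩
    by_cases hj : j = i
    · exact hj ▸ le_sup_left
    · exact (le_iSup₂ (f := fun j (_ : j ≠ i) => N j) j hj).trans le_sup_right
  exact Module.Projective.of_split (N i).subtype ((N i).projectionOnto _ hc)
    (LinearMap.ext fun x => Submodule.projectionOnto_apply_left hc x)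

/-- If `M` is a sum of submodules, every nonzero map from `M` to a simple module
is surjective on some summand. -/
theorem exists_surjective_comp_subtype {ι : Type*} [IsSimpleModule R Q] {N : ι → Submodule R M}
    (hN : ⨆ i, N i = ⊤) {f : M →ₗ[R] Q} (hf : f ≠ 0) :
    ∃ i, Surjective (f ∘ₗ (N i).subtype) := by
  by_contra! h
  refine hf (LinearMap.ker_eq_top.1 (top_le_iff.1 (hN ▸ iSup_le fun i x hx => ?_)))
  exact LinearMap.congr_fun ((LinearMap.surjective_or_eq_zero _).resolve_left (h i)) ⟨x, hx⟩

theorem eq_top_of_sup_map_eq_top {K : Submodule R P} (hK : ∀ U, U ⊔ K = ⊤ → U = ⊤)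
    (g : P →ₗ[R] Q) {U : Submodule R Q} (hU : U ⊔ K.map g = ⊤) : U = ⊤ := by
  have hc : U.comap g = ⊤ := by
    refine hK _ (eq_top_iff.2 fun p _ => ?_)
    obtain ⟨u, hu, _, ⟨k, hk, rfl⟩, h⟩ :=
      Submodule.mem_sup.1 (hU ▸ Submodule.mem_top : g p ∈ U ⊔ K.map g)
    rw [← sub_add_cancel p k]
    refine Submodule.add_mem_sup ?_ hk
    rwa [Submodule.mem_comap, map_sub, ← h, add_sub_cancel_right]
  rw [← hU, eq_comm, sup_eq_left]
  exact Submodule.map_le_iff_le_comap.2 (hc ▸ le_top)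

theorem eq_top_of_sup_iSup_eq_top {ι : Type*} [Fintype ι] {L : ι → Submodule R M}
    (hL : ∀ i U, U ⊔ L i = ⊤ → U = ⊤) {U : Submodule R M} (hU : U ⊔ ⨆ i, L i = ⊤) : U = ⊤ := by
  classical
  have key (s : Finset ι) : U ⊔ s.sup L = ⊤ → U = ⊤ := by
    induction s using Finset.induction_on with
    | empty => simp
    | insert i s _ ih =>
      intro h
      refine ih (hL i _ ?_)
      rwa [sup_assoc, sup_comm _ (L i), ← Finset.sup_insert]
  exact key Finset.univ (by rwa [Finset.sup_univ_eq_iSup])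

end

section

variable {R M ι : Type*} [Ring R] [AddCommGroup M] [Module R M] [Fintype ι] [DecidableEq ι]
  {P : ι → Type*} [∀ i, AddCommGroup (P i)] [∀ i, Module R (P i)] {f : ∀ i, P i →ₗ[R] M}

/-- An irredundant finite family of maps from local projective modules covering `M` gives
a projective cover of `M`. -/
theorem isModuleProjectiveCover_lsum [∀ i, Module.Projective R (P i)]
    (hP : ∀ i, IsLocalModule R (P i)) (hf : ⨆ i, LinearMap.range (f i) = ⊤)
    (hmin : ∀ i, ⨆ (j) (_ : j ≠ i), LinearMap.range (f j) ≠ ⊤) :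
    IsModuleProjectiveCover R (LinearMap.lsum R P ℕ f) := by
  refine ⟨.of_equiv' (DirectSum.linearEquivFunOnFintype R ι P), ?_, fun U hU => ?_⟩
  · refine LinearMap.range_eq_top.1 (top_le_iff.1 (hf ▸ iSup_le fun i => ?_))
    rintro _ ⟨x, rfl⟩
    exact ⟨Pi.single i x, LinearMap.lsum_piSingle ..⟩
  · choose K hK hmax using hP
    refine eq_top_of_sup_iSup_eq_top (L := fun i => (K i).map (LinearMap.single R P i))
      (fun i V => eq_top_of_sup_map_eq_top (fun W hW => ?_) _)
      (top_le_iff.1 (hU ▸ sup_le_sup_left (fun x hx => ?_) U))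
    · by_contra hW'
      exact hK i (by rw [← hW, sup_eq_right.2 (hmax i W hW')])
    · rw [Submodule.iSup_map_single]
      intro i _
      by_contra hxi
      have hspan : Submodule.span R {x i} = ⊤ := by
        by_contra h
        exact hxi (hmax i _ h (Submodule.mem_span_singleton_self _))
      have hle : LinearMap.range (f i) ≤ ⨆ (j) (_ : j ≠ i), LinearMap.range (f j) := by
        rintro _ ⟨y, rfl⟩
        obtain ⟨r, rfl⟩ :=
          Submodule.mem_span_singleton.1 (hspan ▸ Submodule.mem_top : y ∈ Submodule.span R {x i})
        have hx' : ∑ j, f j (x j) = 0 := by simpa using hx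
        rw [← Finset.add_sum_erase _ _ (Finset.mem_univ i), add_eq_zero_iff_eq_neg] at hx'
        rw [map_smul, hx']
        refine Submodule.smul_mem _ _ (Submodule.neg_mem _ (Submodule.sum_mem _ fun j hj => ?_))
        exact Submodule.mem_iSup_of_mem j
          (Submodule.mem_iSup_of_mem (Finset.ne_of_mem_erase hj) ⟨_, rfl⟩)
      refine hmin i (top_le_iff.1 (hf ▸ iSup_le fun j => ?_))
      by_cases hj : j = i
      · exact hj ▸ hle
      · exact le_iSup₂ (f := fun j (_ : j ≠ i) => LinearMap.range (f j)) j hj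

theorem iSupIndep_range_of_injective_lsum (hf : Injective (LinearMap.lsum R P ℕ f)) :
    iSupIndep fun i => LinearMap.range (f i) := by
  intro i
  rw [Submodule.disjoint_def]
  rintro _ ⟨y, rfl⟩ hy
  have hle : ⨆ (j) (_ : j ≠ i), LinearMap.range (f j) ≤
      (LinearMap.ker (LinearMap.proj i)).map (LinearMap.lsum R P ℕ f) := by
    refine iSup₂_le fun j hj => ?_
    rintro _ ⟨x, rfl⟩
    exact ⟨Pi.single j x, by simp [Pi.single_eq_of_ne hj.symm], LinearMap.lsum_piSingle ..⟩
  obtain ⟨z, hz, hzy⟩ := hle hy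
  have hzi : z = Pi.single i y :=
    hf (hzy.trans (LinearMap.lsum_piSingle ..).symm)
  have hy0 : y = 0 := by simpa [hzi] using hz
  rw [hy0, map_zero]

end

/-- If every simple module has a projective cover, then every finitely generated module has
a projective cover by a finite direct sum of local projective modules. -/
theorem exists_isModuleProjectiveCover_lsum {R : Type u} [Ring R]
    (h : ∀ S : ModuleCat.{u} R, IsSimpleModule R S →
      ∃ (P : ModuleCat.{u} R) (π : P →ₗ[R] S), IsModuleProjectiveCover R π)
    (M : Type u) [AddCommGroup M] [Module R M] [Module.Finite R M] :
    ∃ (n : ℕ) (P : Fin n → ModuleCat.{u} R) (f : ∀ i, P i →ₗ[R] M),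
      (∀ i, Module.Projective R (P i)) ∧ (∀ i, IsLocalModule R (P i)) ∧
      IsModuleProjectiveCover R (LinearMap.lsum R (fun i => P i) ℕ f) := by
  classical
  let C : Set (Submodule R M) := {N | ∃ (P : ModuleCat.{u} R) (f : P →ₗ[R] M),
    Module.Projective R P ∧ IsLocalModule R P ∧ LinearMap.range f = N}
  have hC : sSup C = ⊤ := by
    by_contra hne
    obtain ⟨m, hm, hle⟩ := (eq_top_or_exists_le_coatom (sSup C)).resolve_left hne
    have hS : IsSimpleModule R (M ⧸ m) := isSimpleModule_iff_isCoatom.2 hm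
    obtain ⟨P, π, hπ⟩ := h (ModuleCat.of R (M ⧸ m)) hS
    have := hπ.1
    obtain ⟨g, hg⟩ := Module.projective_lifting_property m.mkQ π m.mkQ_surjective
    have hgm : LinearMap.range g ≤ m :=
      (le_sSup ⟨P, g, hπ.1, hπ.isLocalModule, rfl⟩ : LinearMap.range g ≤ sSup C).trans hle
    have := IsSimpleModule.nontrivial R (M ⧸ m)
    obtain ⟨y, hy⟩ := exists_ne (0 : M ⧸ m)
    obtain ⟨x, rfl⟩ := hπ.2.1 y
    refine hy ?_
    rw [← hg]
    exact (Submodule.Quotient.mk_eq_zero m).2 (hgm ⟨x, rfl⟩)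
  have hfin : ∃ t : Finset (Submodule R M), ↑t ⊆ C ∧ t.sup id = ⊤ := by
    obtain ⟨t, ht, hle⟩ := (CompleteLattice.isCompactElement_iff_exists_le_sSup_of_le_sSup _ _).1
      ((Submodule.fg_iff_compact _).1 (Module.Finite.fg_top (R := R) (M := M))) C hC.ge
    exact ⟨t, ht, top_le_iff.1 hle⟩
  obtain ⟨t, ⟨htC, htop⟩, hmin⟩ := exists_minimal_of_wellFoundedLT _ hfin
  let e := t.equivFin.symm
  choose P f hproj hloc hrange using fun i => htC (e i).2
  refine ⟨t.card, P, f, hproj, hloc, isModuleProjectiveCover_lsum hloc ?_ fun i hi => ?_⟩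
  · simp only [hrange]
    rw [e.iSup_comp (g := fun N : t => (N : Submodule R M)), ← htop,
      Finset.sup_eq_iSup, iSup_subtype]
    rfl
  · have hsup : (t.erase (e i)).sup id = ⊤ := by
      refine top_le_iff.1 (hi ▸ iSup₂_le fun j hj => ?_)
      rw [hrange]
      exact Finset.le_sup (f := id) (Finset.mem_erase.2
        ⟨fun h => hj (e.injective (Subtype.ext h)), (e j).2⟩)
    exact Finset.notMem_erase _ _ (hmin
      ⟨(Finset.coe_subset.2 (Finset.erase_subset _ _)).trans htC, hsup⟩
      (Finset.erase_subset _ _) (e i).2)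

/-- If every simple module has a projective cover, then every finitely generated projective module
is a finite direct sum of submodules with local endomorphism rings. -/
theorem exists_isInternal_isLocalRing_end {R : Type u} [Ring R]
    (h : ∀ S : ModuleCat.{u} R, IsSimpleModule R S →
      ∃ (P : ModuleCat.{u} R) (π : P →ₗ[R] S), IsModuleProjectiveCover R π)
    (M : Type u) [AddCommGroup M] [Module R M] [Module.Finite R M] [Module.Projective R M] :
    ∃ (n : ℕ) (N : Fin n → Submodule R M), DirectSum.IsInternal N ∧
      ∀ i, IsLocalRing (Module.End R (N i)) := by
  obtain ⟨n, P, f, hproj, hloc, hcov⟩ := exists_isModuleProjectiveCover_lsum h M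
  set F := LinearMap.lsum R (fun i => P i) ℕ f with hF
  have hinj : Injective F := by
    obtain ⟨g, hg⟩ := LinearMap.exists_rightInverse_of_surjective F
      (LinearMap.range_eq_top.2 hcov.2.1)
    have hFg (x : M) : F (g x) = x := LinearMap.congr_fun hg x
    have hg_top : LinearMap.range g = ⊤ := by
      refine hcov.2.2 _ (eq_top_iff.2 fun x _ => ?_)
      rw [← add_sub_cancel (g (F x)) x]
      exact Submodule.add_mem_sup ⟨_, rfl⟩ (by simp [hFg])
    intro x y hxy
    obtain ⟨x, rfl⟩ := LinearMap.range_eq_top.1 hg_top x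
    obtain ⟨y, rfl⟩ := LinearMap.range_eq_top.1 hg_top y
    rw [hFg, hFg] at hxy
    rw [hxy]
  have hinj' (i : Fin n) : Injective (f i) := by
    intro x y hxy
    exact Pi.single_injective i (hinj (by simpa only [hF, LinearMap.lsum_piSingle] using hxy))
  refine ⟨n, fun i => LinearMap.range (f i),
    (DirectSum.isInternal_submodule_iff_iSupIndep_and_iSup_eq_top _).2
      ⟨iSupIndep_range_of_injective_lsum hinj, ?_⟩, fun i => ?_⟩
  · refine eq_top_iff.2 fun x _ => ?_
    obtain ⟨y, rfl⟩ := hcov.2.1 x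
    simp only [hF, LinearMap.lsum_apply, LinearMap.sum_apply]
    exact Submodule.sum_mem _ fun i _ => Submodule.mem_iSup_of_mem i ⟨_, rfl⟩
  · have := (hloc i).isLocalRing_end
    exact isLocalRing_end_of_linearEquiv (LinearEquiv.ofInjective (f i) (hinj' i))

/-- A ring is free of rank one as a right module over itself. -/
def opLinearEquivSelf (Λ : Type*) [Ring Λ] : Λᵐᵒᵖ ≃ₗ[Λᵐᵒᵖ] Λ where
  __ := MulOpposite.opAddEquiv.symm
  map_smul' _ _ := rfl

/-- For an associative ring `Λ` the following are equivalent (right `Λ`-modules being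
modules over `Λᵐᵒᵖ`):
(1) every finitely generated projective right `Λ`-module decomposes into a finite direct
    sum of submodules with local endomorphism rings (i.e. the category of finitely
    generated projective right `Λ`-modules is a Krull-Schmidt category);
(2) `Λ` admits a decomposition `Λ = P₁ ⊕ … ⊕ P_r` into right submodules each having a
    local endomorphism ring;
(3) every simple right `Λ`-module admits a projective cover;
(4) every finitely generated right `Λ`-module admits a projective cover. -/
theorem semiperfect_tfae (Λ : Type u) [Ring Λ] :
    ((∀ M : ModuleCat.{u} Λᵐᵒᵖ, Module.Finite Λᵐᵒᵖ M → Module.Projective Λᵐᵒᵖ M →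
        ∃ (n : ℕ) (N : Fin n → Submodule Λᵐᵒᵖ M), DirectSum.IsInternal N ∧
          ∀ i, IsLocalRing (Module.End Λᵐᵒᵖ (N i))) ↔
      (∃ (r : ℕ) (P : Fin r → Submodule Λᵐᵒᵖ Λ), DirectSum.IsInternal P ∧
          ∀ i, IsLocalRing (Module.End Λᵐᵒᵖ (P i)))) ∧
    ((∃ (r : ℕ) (P : Fin r → Submodule Λᵐᵒᵖ Λ), DirectSum.IsInternal P ∧
          ∀ i, IsLocalRing (Module.End Λᵐᵒᵖ (P i))) ↔
      (∀ M : ModuleCat.{u} Λᵐᵒᵖ, IsSimpleModule Λᵐᵒᵖ M →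
        ∃ (P : ModuleCat.{u} Λᵐᵒᵖ) (π : P →ₗ[Λᵐᵒᵖ] M),
          IsModuleProjectiveCover Λᵐᵒᵖ π)) ∧
    ((∀ M : ModuleCat.{u} Λᵐᵒᵖ, IsSimpleModule Λᵐᵒᵖ M →
        ∃ (P : ModuleCat.{u} Λᵐᵒᵖ) (π : P →ₗ[Λᵐᵒᵖ] M),
          IsModuleProjectiveCover Λᵐᵒᵖ π) ↔
      (∀ M : ModuleCat.{u} Λᵐᵒᵖ, Module.Finite Λᵐᵒᵖ M →
        ∃ (P : ModuleCat.{u} Λᵐᵒᵖ) (π : P →ₗ[Λᵐᵒᵖ] M),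
          IsModuleProjectiveCover Λᵐᵒᵖ π)) := by
  have h12 : ∀ _ : (∀ M : ModuleCat.{u} Λᵐᵒᵖ, Module.Finite Λᵐᵒᵖ M → Module.Projective Λᵐᵒᵖ M →
        ∃ (n : ℕ) (N : Fin n → Submodule Λᵐᵒᵖ M), DirectSum.IsInternal N ∧
          ∀ i, IsLocalRing (Module.End Λᵐᵒᵖ (N i))),
      ∃ (r : ℕ) (P : Fin r → Submodule Λᵐᵒᵖ Λ), DirectSum.IsInternal P ∧
          ∀ i, IsLocalRing (Module.End Λᵐᵒᵖ (P i)) := fun h =>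
    h (ModuleCat.of Λᵐᵒᵖ Λ) (.equiv (opLinearEquivSelf Λ)) (.of_equiv' (opLinearEquivSelf Λ))
  have h23 : ∀ _ : (∃ (r : ℕ) (P : Fin r → Submodule Λᵐᵒᵖ Λ), DirectSum.IsInternal P ∧
          ∀ i, IsLocalRing (Module.End Λᵐᵒᵖ (P i))),
      ∀ M : ModuleCat.{u} Λᵐᵒᵖ, IsSimpleModule Λᵐᵒᵖ M →
        ∃ (P : ModuleCat.{u} Λᵐᵒᵖ) (π : P →ₗ[Λᵐᵒᵖ] M), IsModuleProjectiveCover Λᵐᵒᵖ π := by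
    rintro ⟨r, P, hP, hloc⟩ M hM
    have : Module.Projective Λᵐᵒᵖ Λ := .of_equiv' (opLinearEquivSelf Λ)
    have := IsSimpleModule.nontrivial Λᵐᵒᵖ M
    obtain ⟨y, hy⟩ := exists_ne (0 : M)
    have hf : LinearMap.toSpanSingleton Λᵐᵒᵖ M y ∘ₗ (opLinearEquivSelf Λ).symm.toLinearMap ≠ 0 := by
      intro h
      refine hy ?_
      simpa using LinearMap.congr_fun h (opLinearEquivSelf Λ 1)
    obtain ⟨i, hi⟩ := exists_surjective_comp_subtype hP.submodule_iSup_eq_top hf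
    have := projective_of_isInternal hP i
    have := hloc i
    exact ⟨ModuleCat.of Λᵐᵒᵖ (P i), _, isModuleProjectiveCover_of_isLocalRing_end hi⟩
  have h31 : ∀ _ : (∀ M : ModuleCat.{u} Λᵐᵒᵖ, IsSimpleModule Λᵐᵒᵖ M →
        ∃ (P : ModuleCat.{u} Λᵐᵒᵖ) (π : P →ₗ[Λᵐᵒᵖ] M), IsModuleProjectiveCover Λᵐᵒᵖ π),
      ∀ M : ModuleCat.{u} Λᵐᵒᵖ, Module.Finite Λᵐᵒᵖ M → Module.Projective Λᵐᵒᵖ M →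
        ∃ (n : ℕ) (N : Fin n → Submodule Λᵐᵒᵖ M), DirectSum.IsInternal N ∧
          ∀ i, IsLocalRing (Module.End Λᵐᵒᵖ (N i)) :=
    fun h M _ _ => exists_isInternal_isLocalRing_end h M
  refine ⟨⟨h12, fun h => h31 (h23 h)⟩, ⟨h23, fun h => h12 (h31 h)⟩, fun h M _ => ?_,
    fun h M _ => h M inferInstance⟩
  obtain ⟨n, P, f, -, -, hcov⟩ := exists_isModuleProjectiveCover_lsum h M
  exact ⟨ModuleCat.of Λᵐᵒᵖ (∀ i, P i), _, hcov⟩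
end
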